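/- For k ≥ 1 let B_k(v,y,x) = Σ_{n≥0} Σ_π v^{lds(π)} y^{r(π)} x^n, the sum over all Motzkin permutations π of length n that avoid the pattern 12…(k+1), where r(π) is the number of rises of π, regarded as a formal power series in the three variables v, y, x. Then (1 − vx)·B_1(v,y,x) = 1, and for every k ≥ 2, (1 − vx − vyx²·B_{k−1}(v,y,x))·B_k(v,y,x) = 1. -/

import Mathlib

/-- `π` avoids the classical pattern 132. -/
def Avoids132 {n : ℕ} (π : Equiv.Perm (Fin n)) : Prop :=
  ¬ ∃ i j k : Fin n, i < j ∧ j < k ∧ π i < π k ∧ π k < π j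

/-- `π` avoids the generalized pattern 1-23. -/
def Avoids1_23 {n : ℕ} (π : Equiv.Perm (Fin n)) : Prop :=
  ¬ ∃ (a b : Fin n) (h : (b : ℕ) + 1 < n), a < b ∧ π a < π b ∧ π b < π ⟨(b : ℕ) + 1, h⟩

/-- A Motzkin permutation avoids both 132 and 1-23. -/
def IsMotzkinPerm {n : ℕ} (π : Equiv.Perm (Fin n)) : Prop :=
  Avoids132 π ∧ Avoids1_23 π

/-- `π` has an increasing subsequence of length `k`, i.e. contains the pattern `12…k`. -/
def HasIncr (k : ℕ) {n : ℕ} (π : Equiv.Perm (Fin n)) : Prop :=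
  ∃ f : Fin k → Fin n, StrictMono f ∧ StrictMono fun i => π (f i)

/-- Length of the longest decreasing subsequence of `π`. -/
noncomputable def lds {n : ℕ} (π : Equiv.Perm (Fin n)) : ℕ :=
  sSup {m : ℕ | ∃ f : Fin m → Fin n, StrictMono f ∧ StrictAnti fun i => π (f i)}

/-- The number of rises of `π`: indices `i` with `π i < π (i+1)`. -/
noncomputable def rises {n : ℕ} (π : Equiv.Perm (Fin n)) : ℕ :=
  Nat.card {i : Fin n // ∃ h : (i : ℕ) + 1 < n, π i < π ⟨(i : ℕ) + 1, h⟩}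

/-- `B k` is the generating function `∑_n ∑_{π ∈ 𝔐_n(12…(k+1))} v^{lds π} y^{rises π} x^n`,
as a formal power series in the three variables `v = X 0`, `y = X 1`, `x = X 2`. -/
noncomputable def B (k : ℕ) : MvPowerSeries (Fin 3) ℚ :=
  fun m : Fin 3 →₀ ℕ =>
    (Nat.card {π : Equiv.Perm (Fin (m 2)) // IsMotzkinPerm π ∧ ¬ HasIncr (k + 1) π ∧
      lds π = m 0 ∧ rises π = m 1} : ℚ)

/-- Trees encoding Motzkin permutations. -/
inductive MTree where
  | e : MTree
  | u : MTree → MTree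
  | b : MTree → MTree → MTree

namespace MTree

def sz : MTree → ℕ
  | e => 0
  | u t => t.sz + 1
  | b s t => s.sz + t.sz + 2

def dl : MTree → ℕ
  | e => 0
  | u t => t.dl + 1
  | b s t => s.dl + t.dl + 1

def rs : MTree → ℕ
  | e => 0
  | u t => t.rs
  | b s t => s.rs + t.rs + 1

def il : MTree → ℕ
  | e => 0
  | u t => max 1 t.il
  | b s t => max (max 2 (s.il + 1)) t.il

def word : ℕ → MTree → List ℕ
  | _, e => []
  | a, u t => (a + t.sz) :: word a t
  | a, b s t => word (a + t.sz + 1) s ++ (a + t.sz) :: (a + t.sz + 1 + s.sz) :: word a t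

theorem word_length (t : MTree) : ∀ a, (t.word a).length = t.sz := by
  induction t with
  | e => simp [word, sz]
  | u t ih => simp [word, sz, ih]
  | b s t ih1 ih2 => intro a; simp [word, sz, ih1, ih2]; omega

theorem mem_word (t : MTree) : ∀ a x, x ∈ t.word a → a ≤ x ∧ x < a + t.sz := by
  induction t with
  | e => simp [word]
  | u t ih =>
    intro a x h
    simp only [word, sz, List.mem_cons] at *
    rcases h with h | h
    · omega
    · have := ih _ _ h; omega
  | b s t ih1 ih2 =>
    intro a x h
    simp only [word, sz, List.mem_cons, List.mem_append] at *
    rcases h with h | h | h | h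
    · have := ih1 _ _ h; omega
    · omega
    · omega
    · have := ih2 _ _ h; omega

theorem word_nodup (t : MTree) : ∀ a, (t.word a).Nodup := by
  induction t with
  | e => simp [word]
  | u t ih =>
    intro a
    simp only [word, List.nodup_cons]
    exact ⟨fun h => by have := mem_word _ _ _ h; omega, ih a⟩
  | b s t ih1 ih2 =>
    intro a
    simp only [word, List.nodup_cons, List.nodup_append, List.mem_cons]
    refine ⟨ih1 _, ⟨?_, ?_, ih2 _⟩, ?_⟩
    · rintro (h | h)
      · omega
      · have := mem_word _ _ _ h; omega
    · intro h; have := mem_word _ _ _ h; omega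
    · intro x hx y hy
      have := mem_word _ _ _ hx
      rcases hy with h | h | h
      · omega
      · omega
      · have := mem_word _ _ _ h; omega

end MTree

theorem split_unique (M : ℕ) : ∀ (L L' R R' : List ℕ), M ∉ L → M ∉ L' →
    L ++ M :: R = L' ++ M :: R' → L = L' ∧ R = R' := by
  intro L
  induction L with
  | nil =>
    intro L' R R' _ h2 h
    cases L' with
    | nil => simpa using h
    | cons a l => simp at h h2; exact absurd h.1 h2.1
  | cons a l ih =>
    intro L' R R' h1 h2 h
    cases L' with
    | nil => simp at h h1; exact absurd h.1.symm h1.1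
    | cons a' l' =>
      simp at h h1 h2
      obtain ⟨h3, h4⟩ := h
      have := ih l' R R' h1.2 h2.2 h4
      simp [h3, this]

namespace MTree

theorem word_inj (s : MTree) : ∀ t a, s.word a = t.word a → s = t := by
  induction s with
  | e => intro t a h; cases t <;> simp [word] at h ⊢
  | u s ih =>
    intro t a h
    have hl := congrArg List.length h
    simp only [word_length] at hl
    cases t with
    | e => simp [word] at h
    | u t => simp [word] at h; rw [ih _ _ h.2]
    | b t1 t2 =>
      exfalso
      simp only [sz] at hl
      simp only [word] at h
      have := split_unique (a + s.sz) [] (word (a + t2.sz + 1) t1 ++ [a + t2.sz])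
        (word a s) (word a t2) (by simp) (by
          simp only [List.mem_append, List.mem_singleton]
          rintro (h | h)
          · have := mem_word _ _ _ h; omega
          · omega) (by
          rw [List.nil_append, h]; simp; omega)
      simp at this
  | b s1 s2 ih1 ih2 =>
    intro t a h
    have hl := congrArg List.length h
    simp only [word_length] at hl
    cases t with
    | e => simp [word] at h
    | u t =>
      exfalso
      simp only [sz] at hl
      simp only [word] at h
      have := split_unique (a + t.sz) [] (word (a + s2.sz + 1) s1 ++ [a + s2.sz])
        (word a t) (word a s2) (by simp) (by
          simp only [List.mem_append, List.mem_singleton]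
          rintro (h | h)
          · have := mem_word _ _ _ h; omega
          · omega) (by
          rw [List.nil_append, ← h]; simp; omega)
      simp at this
    | b t1 t2 =>
      simp only [sz] at hl
      simp only [word] at h
      have := split_unique (a + s2.sz + 1 + s1.sz) (word (a + s2.sz + 1) s1 ++ [a + s2.sz])
        (word (a + t2.sz + 1) t1 ++ [a + t2.sz])
        (word a s2) (word a t2) (by
          simp only [List.mem_append, List.mem_singleton]
          rintro (h | h)
          · have := mem_word _ _ _ h; omega
          · omega) (by
          simp only [List.mem_append, List.mem_singleton]
          rintro (h | h)
          · have := mem_word _ _ _ h; omega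
          · omega) (by
          simp only [List.append_assoc, List.cons_append, List.nil_append, h]
          simp; omega)
      obtain ⟨h1, h2⟩ := this
      have e2 := ih2 _ _ h2
      subst e2
      have := List.append_inj_left' h1 rfl
      rw [ih1 _ _ this]

end MTree

/-- list version of avoiding 132 -/
def LA132 (l : List ℕ) : Prop := l.Triplewise (fun a b c => ¬ (a < c ∧ c < b))

/-- list version of avoiding 1-23 -/
def LA123 : List ℕ → Prop
  | [] => True
  | a :: l => l.IsChain (fun b c => ¬ (a < b ∧ b < c)) ∧ LA123 l

def LR : List ℕ → ℕ
  | [] => 0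
  | [_] => 0
  | a :: b :: l => (if a < b then 1 else 0) + LR (b :: l)

theorem LA132_append {L R : List ℕ} (h : ∀ x ∈ L, ∀ y ∈ R, y < x) (hL : LA132 L) (hR : LA132 R) :
    LA132 (L ++ R) := by
  refine List.triplewise_append.2 ⟨hL, hR, ?_, ?_⟩
  · intro a ha
    refine List.Pairwise.imp_of_mem (R := fun _ _ => True) ?_ (List.pairwise_of_forall (by simp))
    intro x y hx hy _
    have := h a ha y hy
    omega
  · intro a ha
    refine List.Pairwise.imp_of_mem (R := fun _ _ => True) ?_ (List.pairwise_of_forall (by simp))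
    intro x y hx hy _
    have := h x hx a ha
    omega

theorem LA132_snoc {L : List ℕ} {M : ℕ} (h : ∀ x ∈ L, x < M) (hL : LA132 L) :
    LA132 (L ++ [M]) := by
  refine List.triplewise_append.2 ⟨hL, by simp, by simp, ?_⟩
  · intro a ha
    refine List.Pairwise.imp_of_mem (R := fun _ _ => True) ?_ (List.pairwise_of_forall (by simp))
    intro x y hx hy _
    have := h y hy
    simp at ha
    omega

theorem isChain_of_forall_mem {l : List ℕ} {P : ℕ → ℕ → Prop} (h : ∀ x ∈ l, ∀ y ∈ l, P x y) :
    l.IsChain P := by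
  rw [List.isChain_iff_getElem]
  intro i hi
  exact h _ (List.getElem_mem _) _ (List.getElem_mem _)

theorem LA123_append {R : List ℕ} (hR : LA123 R) : ∀ {L : List ℕ} (_ : ∀ x ∈ L, ∀ y ∈ R, y < x)
    (_ : LA123 L), LA123 (L ++ R) := by
  intro L
  induction L with
  | nil => intro _ _; simpa
  | cons a l ih =>
    intro h hL
    refine ⟨?_, ih (fun x hx => h x (by simp [hx])) hL.2⟩
    refine List.isChain_append.2 ⟨hL.1, ?_, ?_⟩
    · apply isChain_of_forall_mem
      intro x hx y hy
      have := h a (by simp) x hx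
      omega
    · intro x hx y hy
      have := h x (by simp [List.mem_of_getLast? hx]) y (List.mem_of_mem_head? hy)
      omega

theorem LA123_snoc {m M : ℕ} : ∀ {L : List ℕ} (_ : ∀ x ∈ L, m < x)
    (_ : LA123 L), LA123 (L ++ [m, M]) := by
  intro L
  induction L with
  | nil => intro _ _; simp [LA123]
  | cons a l ih =>
    intro h hL
    refine ⟨?_, ih (fun x hx => h x (by simp [hx])) hL.2⟩
    refine List.isChain_append.2 ⟨hL.1, ?_, ?_⟩
    · have := h a (by simp)
      simp; omega
    · intro x hx y hy
      have := h x (by simp [List.mem_of_getLast? hx])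
      simp at hy
      omega

theorem LR_mid (x y : ℕ) (R : List ℕ) : ∀ L : List ℕ,
    LR (L ++ x :: y :: R) = LR (L ++ [x]) + (if x < y then 1 else 0) + LR (y :: R) := by
  intro L
  induction L with
  | nil => simp [LR]
  | cons a l ih =>
    cases l with
    | nil => simp [LR]; omega
    | cons b l => 
      simp only [List.cons_append, LR] at ih ⊢
      omega

theorem LR_snoc (m : ℕ) : ∀ L : List ℕ, (∀ x ∈ L, m < x) → LR (L ++ [m]) = LR L := by
  intro L
  induction L with
  | nil => simp [LR]
  | cons a l ih =>
    intro h
    have ih := ih (fun x hx => h x (by simp [hx]))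
    cases l with
    | nil => simp [LR]; exact (h a (by simp)).le
    | cons b l => 
      simp only [List.cons_append, LR] at ih ⊢
      omega

theorem LR_cons (M : ℕ) : ∀ L : List ℕ, (∀ x ∈ L, x < M) → LR (M :: L) = LR L := by
  intro L h
  cases L with
  | nil => simp [LR]
  | cons a l => simp [LR]; exact (h a (by simp)).le

namespace MTree

theorem word_132 (t : MTree) : ∀ a, LA132 (t.word a) := by
  induction t with
  | e => intro a; simp [word, LA132]
  | u t ih =>
    intro a
    refine LA132_append (L := [a + t.sz]) ?_ (by simp [LA132]) (ih a)
    intro x hx y hy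
    have := mem_word _ _ _ hy
    simp at hx; omega
  | b s t ih1 ih2 =>
    intro a
    have h1 : LA132 ((word (a + t.sz + 1) s ++ [a + t.sz]) ++ [a + t.sz + 1 + s.sz]) := by
      apply LA132_snoc
      · intro x hx
        simp only [List.mem_append, List.mem_singleton] at hx
        rcases hx with h | h
        · have := mem_word _ _ _ h; omega
        · omega
      · apply LA132_append _ (ih1 _) (by simp [LA132])
        intro x hx y hy
        have := mem_word _ _ _ hx
        simp at hy; omega
    have h2 := LA132_append (R := word a t) ?_ h1 (ih2 _)
    · simpa [word] using h2
    · intro x hx y hy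
      have := mem_word _ _ _ hy
      simp only [List.mem_append, List.mem_singleton] at hx
      rcases hx with (h | h) | h
      · have := mem_word _ _ _ h; omega
      · omega
      · omega

theorem word_123 (t : MTree) : ∀ a, LA123 (t.word a) := by
  induction t with
  | e => intro a; simp [word, LA123]
  | u t ih =>
    intro a
    refine LA123_append (L := [a + t.sz]) (ih a) ?_ (by simp [LA123]) 
    intro x hx y hy
    have := mem_word _ _ _ hy
    simp at hx; omega
  | b s t ih1 ih2 =>
    intro a
    have h1 : LA123 ((word (a + t.sz + 1) s ++ [a + t.sz, a + t.sz + 1 + s.sz])) := by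
      apply LA123_snoc _ (ih1 _)
      intro x hx
      have := mem_word _ _ _ hx; omega
    have h2 := LA123_append (R := word a t) (ih2 _) ?_ h1
    · simpa [word] using h2
    · intro x hx y hy
      have := mem_word _ _ _ hy
      simp only [List.mem_append, List.mem_cons, List.not_mem_nil, or_false] at hx
      rcases hx with h | h | h
      · have := mem_word _ _ _ h; omega
      · omega
      · omega

theorem word_LR (t : MTree) : ∀ a, LR (t.word a) = t.rs := by
  induction t with
  | e => intro a; simp [word, LR, rs]
  | u t ih =>
    intro a
    rw [word, LR_cons, ih, rs]
    intro y hy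
    have := mem_word _ _ _ hy
    omega
  | b s t ih1 ih2 =>
    intro a
    rw [word, LR_mid, LR_cons, LR_snoc, ih1, ih2, rs, if_pos (by omega)]
    · omega
    · intro y hy
      have := mem_word _ _ _ hy
      omega
    · intro y hy
      have := mem_word _ _ _ hy
      omega

theorem il_le (t : MTree) : ∀ a (s : List ℕ), s.Sublist (t.word a) → s.Pairwise (· < ·) →
    s.length ≤ t.il := by
  induction t with
  | e => intro a s h; simp [word] at h; simp [h]
  | u t ih =>
    intro a s h hp
    rw [word, List.sublist_cons_iff] at h
    rw [il]
    rcases h with h | ⟨r, rfl, h⟩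
    · have := ih _ _ h hp; omega
    · rw [List.pairwise_cons] at hp
      cases r with
      | nil => simp
      | cons x r =>
        have h1 := hp.1 x (by simp)
        have := mem_word _ _ _ (h.subset (List.mem_cons_self))
        omega
  | b t1 t2 ih1 ih2 =>
    intro a s h hp
    rw [word, List.sublist_append_iff] at h
    rw [il]
    obtain ⟨s1, s2, rfl, h1, h2⟩ := h
    have : (a + t2.sz) :: (a + t2.sz + 1 + t1.sz) :: word a t2 =
      [a + t2.sz, a + t2.sz + 1 + t1.sz] ++ word a t2 := rfl
    rw [this, List.sublist_append_iff] at h2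
    obtain ⟨s3, s4, rfl, h3, h4⟩ := h2
    simp only [List.pairwise_append, List.mem_append] at hp
    obtain ⟨p1, ⟨p3, p4, p34⟩, p1'⟩ := hp
    have q1 := ih1 _ _ h1 p1
    have q4 := ih2 _ _ h4 p4
    simp only [List.length_append]
    have q3 := h3.length_le
    simp at q3
    cases s4 with
    | nil =>
      cases s1 with
      | nil => simp; omega
      | cons x s1 =>
        have m1 := mem_word _ _ _ (h1.subset (List.mem_cons_self))
        have : s3.length ≤ 1 := by
          rw [List.sublist_cons_iff] at h3
          rcases h3 with h3 | ⟨r, rfl, h3⟩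
          · simpa using h3.length_le
          · have := p1' x (by simp) (a + t2.sz) (by simp)
            omega
        simp only [List.length_cons, List.length_nil] at *
        omega
    | cons y s4 =>
      have m4 := mem_word _ _ _ (h4.subset (List.mem_cons_self))
      cases s1 with
      | cons x s1 =>
        have m1 := mem_word _ _ _ (h1.subset (List.mem_cons_self))
        have := p1' x (by simp) y (by simp)
        omega
      | nil =>
        cases s3 with
        | nil => simp only [List.length_nil, zero_add]; omega
        | cons z s3 =>
          have := h3.subset (List.mem_cons_self)
          have := p34 z (by simp) y (by simp)
          simp at *
          omega

theorem dl_le (t : MTree) : ∀ a (s : List ℕ), s.Sublist (t.word a) → s.Pairwise (· > ·) →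
    s.length ≤ t.dl := by
  induction t with
  | e => intro a s h; simp [word] at h; simp [h]
  | u t ih =>
    intro a s h hp
    rw [word, List.sublist_cons_iff] at h
    rw [dl]
    rcases h with h | ⟨r, rfl, h⟩
    · have := ih _ _ h hp; omega
    · rw [List.pairwise_cons] at hp
      have := ih _ _ h hp.2
      simpa
  | b t1 t2 ih1 ih2 =>
    intro a s h hp
    rw [word, List.sublist_append_iff] at h
    rw [dl]
    obtain ⟨s1, s2, rfl, h1, h2⟩ := h
    have : (a + t2.sz) :: (a + t2.sz + 1 + t1.sz) :: word a t2 =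
      [a + t2.sz, a + t2.sz + 1 + t1.sz] ++ word a t2 := rfl
    rw [this, List.sublist_append_iff] at h2
    obtain ⟨s3, s4, rfl, h3, h4⟩ := h2
    simp only [List.pairwise_append, List.mem_append] at hp
    obtain ⟨p1, ⟨p3, p4, p34⟩, p1'⟩ := hp
    have q1 := ih1 _ _ h1 p1
    have q4 := ih2 _ _ h4 p4
    simp only [List.length_append]
    have q3 : s3.length ≤ 1 := by
      have := h3.length_le
      by_contra hc
      have := h3.eq_of_length (by simp at this ⊢; omega)
      subst this
      simp at p3
      omega
    omega

theorem il_ex (t : MTree) : ∀ a, ∃ s : List ℕ, s.Sublist (t.word a) ∧ s.Pairwise (· < ·) ∧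
    s.length = t.il := by
  induction t with
  | e => intro a; exact ⟨[], by simp, by simp, rfl⟩
  | u t ih =>
    intro a
    obtain ⟨s, h1, h2, h3⟩ := ih a
    rw [word, il]
    rcases max_cases 1 t.il with h | h
    · exact ⟨[a + t.sz], by simp, by simp, by simp [h.1]⟩
    · exact ⟨s, h1.cons _, h2, by rw [h3, h.1]⟩
  | b t1 t2 ih1 ih2 =>
    intro a
    rw [word, il]
    rcases max_cases (max 2 (t1.il + 1)) t2.il with h | h
    · rw [h.1]
      rcases max_cases 2 (t1.il + 1) with h | h
      · rw [h.1]
        exact ⟨[a + t2.sz, a + t2.sz + 1 + t1.sz], by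
          apply List.sublist_append_of_sublist_right
          simp, by simp; omega, by simp⟩
      · rw [h.1]
        obtain ⟨s, h1, h2, h3⟩ := ih1 (a + t2.sz + 1)
        refine ⟨s ++ [a + t2.sz + 1 + t1.sz], ?_, ?_, by simp [h3]⟩
        · apply h1.append
          apply List.Sublist.cons
          simp
        · rw [List.pairwise_append]
          refine ⟨h2, by simp, ?_⟩
          intro x hx y hy
          have := mem_word _ _ _ (h1.subset hx)
          simp at hy; omega
    · obtain ⟨s, h1, h2, h3⟩ := ih2 a
      refine ⟨s, ?_, h2, by rw [h3, h.1]⟩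
      apply List.sublist_append_of_sublist_right
      exact (h1.cons _).cons _

theorem dl_ex (t : MTree) : ∀ a, ∃ s : List ℕ, s.Sublist (t.word a) ∧ s.Pairwise (· > ·) ∧
    s.length = t.dl := by
  induction t with
  | e => intro a; exact ⟨[], by simp, by simp, rfl⟩
  | u t ih =>
    intro a
    obtain ⟨s, h1, h2, h3⟩ := ih a
    rw [word, dl]
    refine ⟨(a + t.sz) :: s, by simpa, ?_, by simp [h3]⟩
    rw [List.pairwise_cons]
    refine ⟨?_, h2⟩
    intro x hx
    have := mem_word _ _ _ (h1.subset hx)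
    omega
  | b t1 t2 ih1 ih2 =>
    intro a
    rw [word, dl]
    obtain ⟨s, h1, h2, h3⟩ := ih1 (a + t2.sz + 1)
    obtain ⟨s', h1', h2', h3'⟩ := ih2 a
    refine ⟨s ++ (a + t2.sz) :: s', ?_, ?_, by simp [h3, h3']; omega⟩
    · apply h1.append
      apply List.Sublist.cons_cons
      exact h1'.cons _
    · rw [List.pairwise_append, List.pairwise_cons]
      refine ⟨h2, ⟨?_, h2'⟩, ?_⟩
      · intro x hx
        have := mem_word _ _ _ (h1'.subset hx)
        omega
      · intro x hx y hy
        have := mem_word _ _ _ (h1.subset hx)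
        rw [List.mem_cons] at hy
        rcases hy with h | h
        · omega
        · have := mem_word _ _ _ (h1'.subset h)
          omega

end MTree

theorem range_split {L R : List ℕ} {a n : ℕ} (h : (L ++ R).Perm (List.range' a n))
    (hLR : ∀ x ∈ L, ∀ y ∈ R, y < x) :
    R.Perm (List.range' a R.length) ∧ L.Perm (List.range' (a + R.length) L.length) := by
  have hn : R.length + L.length = n := by
    have := h.length_eq; simp at this; omega
  have p1 := List.mergeSort_perm R (· ≤ ·)
  have p2 := List.mergeSort_perm L (· ≤ ·)
  have key : R.mergeSort (· ≤ ·) ++ L.mergeSort (· ≤ ·) = List.range' a n := by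
    apply List.Perm.eq_of_pairwise' (r := (· ≤ ·))
    · rw [List.pairwise_append]
      refine ⟨List.pairwise_mergeSort' _ _, List.pairwise_mergeSort' _ _, ?_⟩
      intro x hx y hy
      exact (hLR y (p2.subset hy) x (p1.subset hx)).le
    · exact (List.pairwise_lt_range' (s := a) (n := n)).imp le_of_lt
    · exact ((p1.append p2).trans List.perm_append_comm).trans h
  rw [← hn, ← List.range'_append_1] at key
  obtain ⟨k1, k2⟩ := List.append_inj key (by simp [p1.length_eq])
  exact ⟨k1 ▸ p1.symm, k2 ▸ p2.symm⟩

theorem LA123_right {R : List ℕ} : ∀ {L : List ℕ}, LA123 (L ++ R) → LA123 R := by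
  intro L
  induction L with
  | nil => exact id
  | cons a l ih => exact fun h => ih h.2

theorem LA123_left {R : List ℕ} : ∀ {L : List ℕ}, LA123 (L ++ R) → LA123 L := by
  intro L
  induction L with
  | nil => intro _; trivial
  | cons a l ih => exact fun h => ⟨(List.isChain_append.1 h.1).1, ih h.2⟩

theorem LA123_mid {R : List ℕ} {m M : ℕ} : ∀ {L : List ℕ}, LA123 (L ++ m :: M :: R) → 
    ∀ x ∈ L, ¬ (x < m ∧ m < M) := by
  intro L
  induction L with
  | nil => simp
  | cons a l ih =>
    intro h x hx
    rw [List.mem_cons] at hx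
    rcases hx with rfl | hx
    · have := (List.isChain_append.1 h.1).2.1
      simp only [List.isChain_cons_cons] at this
      exact this.1
    · exact ih h.2 x hx

theorem word_surj : ∀ (n a : ℕ) (l : List ℕ), l.Perm (List.range' a n) → LA132 l → LA123 l →
    ∃ t : MTree, t.sz = n ∧ t.word a = l := by
  intro n
  induction n using Nat.strong_induction_on with
  | _ n ih =>
  intro a l hl h1 h2
  cases n with
  | zero => 
    simp at hl
    exact ⟨.e, rfl, by simp [MTree.word, hl]⟩
  | succ n =>
    have hM : a + n ∈ l := hl.mem_iff.2 (by simp)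
    obtain ⟨L, R, rfl⟩ := List.append_of_mem hM
    have hp : (L ++ R).Perm (List.range' a n) := by
      have : ((a + n) :: (L ++ R)).Perm ((a + n) :: List.range' a n) := by
        refine List.perm_middle.symm.trans (hl.trans ?_)
        rw [List.range'_1_concat]
        exact List.perm_append_singleton _ _
      exact this.cons_inv
    have hlt : ∀ x ∈ L ++ R, x < a + n := by
      intro x hx
      have := hp.mem_iff.1 hx
      simp at this; omega
    have hnd : (L ++ R).Nodup := hp.nodup_iff.2 List.nodup_range'
    have h1' := List.triplewise_append.1 h1
    have h1R : LA132 R := (List.triplewise_cons.1 h1'.2.1).2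
    have h2R : LA123 R := (LA123_right h2).2
    have hLR : ∀ x ∈ L, ∀ y ∈ R, y < x := by
      intro x hx y hy
      have := (List.pairwise_cons.1 (h1'.2.2.1 x hx)).1 y hy
      have h3 := hlt y (by simp [hy])
      have h4 := (List.nodup_append.1 hnd).2.2 x hx y hy
      omega
    rcases List.eq_nil_or_concat L with rfl | ⟨S, m, rfl⟩
    · obtain ⟨t, ht, ht'⟩ := ih n (by omega) a R hp h1R h2R
      exact ⟨.u t, by simp [MTree.sz, ht], by simp [MTree.word, ht, ht']⟩
    · simp only [List.concat_eq_append, List.append_assoc, List.cons_append, List.nil_append] at *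
      have hSm : ∀ x ∈ S, ∀ y ∈ m :: R, y < x := by
        intro x hx y hy
        rw [List.mem_cons] at hy
        rcases hy with rfl | hy
        · have h3 := LA123_mid h2 x hx
          have h4 := (List.nodup_append.1 hnd).2.2 x hx y (by simp)
          have h5 := hlt y (by simp)
          omega
        · exact hLR x (by simp [hx]) y hy
      obtain ⟨k1, k2⟩ := range_split hp hSm
      obtain ⟨k3, k4⟩ := range_split (L := [m]) k1 (by
        intro x hx y hy
        exact hLR x (by simp at hx; simp [hx]) y hy)
      simp at k4
      have hlen := hp.length_eq
      simp at hlen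
      have h1S : LA132 S := (List.triplewise_append.1 h1).1
      obtain ⟨t, ht, ht'⟩ := ih R.length (by omega) a R k3 h1R h2R
      obtain ⟨s, hs, hs'⟩ := ih S.length (by omega) _ S k2 h1S (LA123_left h2)
      refine ⟨.b s t, by simp [MTree.sz]; omega, ?_⟩
      simp only [List.length_cons] at hs'
      rw [MTree.word, ht, ht', add_assoc a, hs', hs, k4]
      congr 3
      omega

/-- the word of a permutation -/
def pl {n : ℕ} (π : Equiv.Perm (Fin n)) : List ℕ := List.ofFn (fun i => (π i : ℕ))

theorem pl_length {n : ℕ} (π : Equiv.Perm (Fin n)) : (pl π).length = n := by simp [pl]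

theorem pl_getElem {n : ℕ} (π : Equiv.Perm (Fin n)) (i : ℕ) (h : i < (pl π).length) :
    (pl π)[i] = (π ⟨i, by simpa [pl] using h⟩ : ℕ) := by simp [pl]

theorem pl_inj {n : ℕ} {π σ : Equiv.Perm (Fin n)} (h : pl π = pl σ) : π = σ := by
  have := List.ofFn_injective h
  ext i
  exact congrFun this i

theorem pl_perm {n : ℕ} (π : Equiv.Perm (Fin n)) : (pl π).Perm (List.range' 0 n) := by
  have hnd : (pl π).Nodup := by
    unfold pl
    rw [List.nodup_ofFn]
    intro i j h
    exact π.injective (Fin.ext h)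
  rw [List.perm_ext_iff_of_nodup hnd List.nodup_range']
  intro x
  simp only [pl, List.mem_ofFn, List.mem_range'_1]
  constructor
  · rintro ⟨i, rfl⟩
    have := (π i).2
    omega
  · intro h
    exact ⟨π.symm ⟨x, by omega⟩, by simp⟩

theorem exists_pl {n : ℕ} {l : List ℕ} (h1 : l.Nodup) (h2 : l.length = n) (h3 : ∀ x ∈ l, x < n) :
    ∃ π : Equiv.Perm (Fin n), pl π = l := by
  subst h2
  let f : Fin l.length → Fin l.length := fun i => ⟨l.get i, h3 _ (List.get_mem _ _)⟩
  have hf : Function.Injective f := by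
    intro i j h
    have : l.get i = l.get j := congrArg Fin.val h
    exact (List.nodup_iff_injective_get.1 h1) this
  refine ⟨Equiv.ofBijective f (Finite.injective_iff_bijective.1 hf), ?_⟩
  simp [pl, f]

theorem pl_132 {n : ℕ} (π : Equiv.Perm (Fin n)) : Avoids132 π ↔ LA132 (pl π) := by
  unfold Avoids132 LA132
  rw [List.triplewise_iff_getElem]
  simp only [pl_getElem]
  constructor
  · intro h i j k hij hjk hk hc
    rw [pl_length] at hk
    exact h ⟨⟨i, by omega⟩, ⟨j, by omega⟩, ⟨k, by omega⟩, hij, hjk, hc.1, hc.2⟩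
  · rintro h ⟨i, j, k, hij, hjk, h1, h2⟩
    exact h i j k hij hjk (by simp [pl_length]) ⟨h1, h2⟩

theorem LA123_iff : ∀ l : List ℕ, LA123 l ↔ ∀ (i j : ℕ) (_ : i < j) (hj : j + 1 < l.length),
    ¬ (l[i] < l[j] ∧ l[j] < l[j + 1]) := by
  intro l
  induction l with
  | nil => simp [LA123]
  | cons a l ih =>
    simp only [LA123, ih, List.isChain_iff_getElem]
    constructor
    · rintro ⟨h1, h2⟩ i j hij hj
      obtain ⟨j, rfl⟩ : ∃ j', j = j' + 1 := ⟨j - 1, by omega⟩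
      cases i with
      | zero => exact h1 j (by simpa using hj)
      | succ i => exact h2 i j (by omega) (by simpa using hj)
    · intro h
      refine ⟨fun j hj => h 0 (j + 1) (by omega) (by simpa using hj), fun i j hij hj =>
        h (i + 1) (j + 1) (by omega) (by simpa using hj)⟩

theorem pl_123 {n : ℕ} (π : Equiv.Perm (Fin n)) : Avoids1_23 π ↔ LA123 (pl π) := by
  rw [LA123_iff]
  unfold Avoids1_23
  simp only [pl_getElem]
  constructor
  · intro h i j hij hj hc
    rw [pl_length] at hj
    exact h ⟨⟨i, by omega⟩, ⟨j, by omega⟩, hj, hij, hc.1, hc.2⟩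
  · rintro h ⟨i, j, hj, hij, h1, h2⟩
    exact h i j hij (by simpa [pl_length] using hj) ⟨h1, h2⟩

theorem pl_sub {n : ℕ} (π : Equiv.Perm (Fin n)) (r : ℕ → ℕ → Prop) (k : ℕ) :
    (∃ f : Fin k → Fin n, StrictMono f ∧ ∀ i j, i < j → r (π (f i)) (π (f j))) ↔
    ∃ s : List ℕ, s.Sublist (pl π) ∧ s.Pairwise r ∧ s.length = k := by
  constructor
  · rintro ⟨f, hf, h⟩
    refine ⟨List.ofFn (fun i => (π (f i) : ℕ)), ?_, ?_, by simp⟩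
    · rw [List.sublist_iff_exists_fin_orderEmbedding_get_eq]
      refine ⟨OrderEmbedding.ofStrictMono (fun i => Fin.cast (pl_length π).symm
        (f (Fin.cast (by simp) i))) ?_, ?_⟩
      · intro i j hij
        exact hf hij
      · intro i
        simp [pl_getElem]
        rfl
    · rw [List.pairwise_ofFn]
      exact fun i j hij => h i j hij
  · rintro ⟨s, h1, h2, rfl⟩
    rw [List.sublist_iff_exists_fin_orderEmbedding_get_eq] at h1
    obtain ⟨f, hf⟩ := h1
    refine ⟨fun i => Fin.cast (pl_length π) (f i), fun i j hij => f.strictMono hij, ?_⟩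
    intro i j hij
    have := List.pairwise_iff_get.1 h2 i j hij
    rw [hf, hf] at this
    simp only [List.get_eq_getElem, pl_getElem] at this
    exact this

theorem card_rise (n : ℕ) : ∀ (g : Fin n → ℕ),
    Nat.card {i : Fin n // ∃ h : (i : ℕ) + 1 < n, g i < g ⟨(i : ℕ) + 1, h⟩} = LR (List.ofFn g) := by
  induction n with
  | zero => intro g; simp [LR]
  | succ n ih =>
    intro g
    classical
    have key : ∀ (m : ℕ) (f : Fin m → ℕ),
        Nat.card {i : Fin m // ∃ h : (i : ℕ) + 1 < m, f i < f ⟨(i : ℕ) + 1, h⟩} =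
        ∑ i : Fin m, if (∃ h : (i : ℕ) + 1 < m, f i < f ⟨(i : ℕ) + 1, h⟩) then 1 else 0 := by
      intro m f
      rw [Nat.card_eq_fintype_card, Fintype.card_subtype, Finset.card_filter]
    have ih' := ih (fun i => g i.succ)
    rw [key] at ih' ⊢
    rw [Fin.sum_univ_succ]
    have e1 : (∑ i : Fin n, if (∃ h : (i.succ : ℕ) + 1 < n + 1,
        g i.succ < g ⟨(i.succ : ℕ) + 1, h⟩) then 1 else 0) = LR (List.ofFn fun i => g i.succ) := by
      rw [← ih']
      apply Finset.sum_congr rfl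
      intro i _
      congr 1
      simp
    rw [e1, List.ofFn_succ]
    cases n with
    | zero =>
      rw [if_neg (fun h => absurd h.1 (lt_irrefl _)), List.ofFn_zero]
      rfl
    | succ n =>
      rw [List.ofFn_succ, LR]
      have e2 : (∃ h : ((0 : Fin (n + 1 + 1)) : ℕ) + 1 < n + 1 + 1,
          g 0 < g ⟨((0 : Fin (n + 1 + 1)) : ℕ) + 1, h⟩) ↔ g 0 < g (Fin.succ 0) :=
        ⟨fun h => h.2, fun h => ⟨by simp, h⟩⟩
      simp only [e2]

theorem pl_rises {n : ℕ} (π : Equiv.Perm (Fin n)) : rises π = LR (pl π) := by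
  exact card_rise n (fun i => (π i : ℕ))

theorem pl_HasIncr {n : ℕ} {π : Equiv.Perm (Fin n)} {t : MTree} (h : pl π = t.word 0) (k : ℕ) :
    HasIncr k π ↔ k ≤ t.il := by
  have h0 : HasIncr k π ↔
      ∃ f : Fin k → Fin n, StrictMono f ∧ ∀ i j, i < j → (π (f i) : ℕ) < (π (f j)) := Iff.rfl
  rw [h0, pl_sub π (fun x y => x < y), h]
  constructor
  · rintro ⟨s, h1, h2, rfl⟩
    exact t.il_le 0 s h1 h2
  · intro hk
    obtain ⟨s, h1, h2, h3⟩ := t.il_ex 0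
    refine ⟨s.take k, (List.take_sublist _ _).trans h1, h2.sublist (List.take_sublist _ _), ?_⟩
    simp; omega

theorem pl_lds {n : ℕ} {π : Equiv.Perm (Fin n)} {t : MTree} (h : pl π = t.word 0) :
    lds π = t.dl := by
  have hs : {m : ℕ | ∃ f : Fin m → Fin n, StrictMono f ∧ StrictAnti fun i => π (f i)} =
      Set.Iic t.dl := by
    ext k
    have h0 : (∃ f : Fin k → Fin n, StrictMono f ∧ StrictAnti fun i => π (f i)) ↔
      ∃ f : Fin k → Fin n, StrictMono f ∧ ∀ i j, i < j → (π (f i) : ℕ) > (π (f j)) := Iff.rfl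
    rw [Set.mem_ofPred_eq, h0, pl_sub π (fun x y => x > y), h, Set.mem_Iic]
    constructor
    · rintro ⟨s, h1, h2, rfl⟩
      exact t.dl_le 0 s h1 h2
    · intro hk
      obtain ⟨s, h1, h2, h3⟩ := t.dl_ex 0
      refine ⟨s.take k, (List.take_sublist _ _).trans h1, h2.sublist (List.take_sublist _ _), ?_⟩
      simp; omega
  rw [lds, hs, csSup_Iic]

theorem tree_perm (t : MTree) (n : ℕ) (h : t.sz = n) :
    ∃ π : Equiv.Perm (Fin n), pl π = t.word 0 :=
  exists_pl (t.word_nodup 0) (by rw [t.word_length, h]) (fun x hx => by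
    have := t.mem_word _ _ hx; omega)

theorem motz_iff {n : ℕ} (π : Equiv.Perm (Fin n)) :
    IsMotzkinPerm π ↔ LA132 (pl π) ∧ LA123 (pl π) := by
  rw [IsMotzkinPerm, pl_132, pl_123]

theorem tree_equiv (n k d r : ℕ) : Nonempty
    ({t : MTree // t.il ≤ k ∧ t.sz = n ∧ t.dl = d ∧ t.rs = r} ≃
    {π : Equiv.Perm (Fin n) // IsMotzkinPerm π ∧ ¬ HasIncr (k + 1) π ∧
      lds π = d ∧ rises π = r}) := by
  choose F hF using tree_perm
  let G : {t : MTree // t.il ≤ k ∧ t.sz = n ∧ t.dl = d ∧ t.rs = r} →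
    {π : Equiv.Perm (Fin n) // IsMotzkinPerm π ∧ ¬ HasIncr (k + 1) π ∧
      lds π = d ∧ rises π = r} := fun t => ⟨F t.1 n t.2.2.1, by
        have h := hF t.1 n t.2.2.1
        rw [motz_iff, pl_HasIncr h, pl_lds h, pl_rises, h, t.1.word_LR]
        exact ⟨⟨t.1.word_132 0, t.1.word_123 0⟩, by have := t.2.1; omega, t.2.2.2⟩⟩
  refine ⟨Equiv.ofBijective G ⟨?_, ?_⟩⟩
  · intro s t h
    have h1 : F s.1 n s.2.2.1 = F t.1 n t.2.2.1 := congrArg Subtype.val h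
    have h2 := congrArg pl h1
    rw [hF, hF] at h2
    exact Subtype.ext (MTree.word_inj _ _ _ h2)
  · rintro ⟨π, h1, h2, h3, h4⟩
    rw [motz_iff] at h1
    obtain ⟨t, ht, ht'⟩ := word_surj n 0 (pl π) (pl_perm π) h1.1 h1.2
    rw [pl_HasIncr ht'.symm] at h2
    rw [pl_lds ht'.symm] at h3
    rw [pl_rises, ← ht', t.word_LR] at h4
    refine ⟨⟨t, by omega, ht, h3, h4⟩, Subtype.ext (pl_inj ?_)⟩
    exact (hF _ _ _).trans ht'

/-- generating function of a weighted type -/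
noncomputable def GF {α : Type} (w : α → (Fin 3 →₀ ℕ)) : MvPowerSeries (Fin 3) ℚ :=
  fun m => (Nat.card {a : α // w a = m} : ℚ)

theorem coeff_GF {α : Type} (w : α → (Fin 3 →₀ ℕ)) (m : Fin 3 →₀ ℕ) :
    MvPowerSeries.coeff m (GF w) = (Nat.card {a : α // w a = m} : ℚ) := rfl

def FinFib {α : Type} (w : α → (Fin 3 →₀ ℕ)) : Prop := ∀ m, Finite {a : α // w a = m}

theorem GF_equiv {α β : Type} (w : α → (Fin 3 →₀ ℕ)) (w' : β → (Fin 3 →₀ ℕ)) (e : α ≃ β)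
    (h : ∀ a, w a = w' (e a)) : GF w = GF w' := by
  ext m
  rw [coeff_GF, coeff_GF]
  congr 1
  exact Nat.card_congr (e.subtypeEquiv (fun a => by rw [h]))

theorem GF_sum {α β : Type} (w : α → (Fin 3 →₀ ℕ)) (w' : β → (Fin 3 →₀ ℕ)) (h : FinFib w)
    (h' : FinFib w') : GF (Sum.elim w w') = GF w + GF w' := by
  ext m
  have := h m
  have := h' m
  rw [map_add, coeff_GF, coeff_GF, coeff_GF, ← Nat.cast_add, ← Nat.card_sum]
  congr 1
  exact Nat.card_congr (Equiv.subtypeSum)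

theorem FinFib_sum {α β : Type} (w : α → (Fin 3 →₀ ℕ)) (w' : β → (Fin 3 →₀ ℕ)) (h : FinFib w)
    (h' : FinFib w') : FinFib (Sum.elim w w') := by
  intro m
  have := h m
  have := h' m
  exact Finite.of_equiv ({a : α // w a = m} ⊕ {b : β // w' b = m}) (Equiv.subtypeSum (p := fun c => Sum.elim w w' c = m)).symm

theorem GF_shift {α : Type} (w : α → (Fin 3 →₀ ℕ)) (c : Fin 3 →₀ ℕ) :
    GF (fun a => c + w a) = MvPowerSeries.monomial c 1 * GF w := by
  ext m
  rw [MvPowerSeries.coeff_monomial_mul, coeff_GF, coeff_GF]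
  split_ifs with h
  · rw [one_mul]
    congr 1
    apply Nat.card_congr
    apply Equiv.subtypeEquivRight
    intro a
    constructor
    · intro h; rw [← h, add_tsub_cancel_left]
    · intro h'; rw [h', add_tsub_cancel_of_le h]
  · have : IsEmpty {a : α // c + w a = m} := ⟨fun a => h (a.2 ▸ le_self_add)⟩
    simp

theorem FinFib_shift {α : Type} (w : α → (Fin 3 →₀ ℕ)) (c : Fin 3 →₀ ℕ) (h : FinFib w) :
    FinFib (fun a => c + w a) := by
  intro m
  have := h (m - c)
  apply Finite.of_injective (β := {a : α // w a = m - c})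
    (fun a => ⟨a.1, by have h := a.2; exact eq_tsub_of_add_eq ((add_comm _ _).trans h)⟩)
  intro a b h
  exact Subtype.ext (Subtype.mk.inj h)

def prodFib {α β : Type} (w : α → (Fin 3 →₀ ℕ)) (w' : β → (Fin 3 →₀ ℕ)) (m : Fin 3 →₀ ℕ) :
    {p : α × β // w p.1 + w' p.2 = m} ≃
    (Σ q : Finset.HasAntidiagonal.antidiagonal m, {a : α // w a = q.1.1} × {b : β // w' b = q.1.2}) where
  toFun p := ⟨⟨(w p.1.1, w' p.1.2), by simpa using p.2⟩, ⟨p.1.1, rfl⟩, ⟨p.1.2, rfl⟩⟩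
  invFun x := ⟨(x.2.1.1, x.2.2.1), by
    rw [x.2.1.2, x.2.2.2]; exact Finset.HasAntidiagonal.mem_antidiagonal.1 x.1.2⟩
  left_inv p := rfl
  right_inv := by
    rintro ⟨⟨⟨m1, m2⟩, hm⟩, ⟨a, ha⟩, ⟨b, hb⟩⟩
    simp only at ha hb
    subst ha hb
    rfl

theorem FinFib_prod {α β : Type} (w : α → (Fin 3 →₀ ℕ)) (w' : β → (Fin 3 →₀ ℕ)) (h : FinFib w)
    (h' : FinFib w') : FinFib (fun p : α × β => w p.1 + w' p.2) := by
  intro m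
  have := fun q => h q
  have := fun q => h' q
  exact Finite.of_equiv _ (prodFib w w' m).symm

theorem GF_prod {α β : Type} (w : α → (Fin 3 →₀ ℕ)) (w' : β → (Fin 3 →₀ ℕ)) (h : FinFib w)
    (h' : FinFib w') : GF (fun p : α × β => w p.1 + w' p.2) = GF w * GF w' := by
  ext m
  have := fun q => h q
  have := fun q => h' q
  rw [MvPowerSeries.coeff_mul, coeff_GF, Nat.card_congr (prodFib w w' m), Nat.card_sigma]
  simp only [Nat.card_prod, coeff_GF]
  push_cast
  exact Finset.sum_coe_sort (Finset.HasAntidiagonal.antidiagonal m) (fun q : (Fin 3 →₀ ℕ) × (Fin 3 →₀ ℕ) =>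
    (Nat.card {a : α // w a = q.1} : ℚ) * (Nat.card {b : β // w' b = q.2} : ℚ))

theorem GF_unit : GF (fun _ : Unit => (0 : Fin 3 →₀ ℕ)) = 1 := by
  classical
  ext m
  rw [coeff_GF, MvPowerSeries.coeff_one]
  split_ifs with h
  · subst h; simp
  · have : IsEmpty {a : Unit // (0 : Fin 3 →₀ ℕ) = m} := ⟨fun a => h a.2.symm⟩
    simp

theorem FinFib_unit : FinFib (fun _ : Unit => (0 : Fin 3 →₀ ℕ)) := fun _ => inferInstance

/-- weight of a tree -/
noncomputable def wt (t : MTree) : Fin 3 →₀ ℕ :=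
  Finsupp.single 0 t.dl + Finsupp.single 1 t.rs + Finsupp.single 2 t.sz

theorem wt_eq_iff (t : MTree) (m : Fin 3 →₀ ℕ) :
    wt t = m ↔ t.sz = m 2 ∧ t.dl = m 0 ∧ t.rs = m 1 := by
  constructor
  · rintro rfl; simp [wt]
  · rintro ⟨h1, h2, h3⟩
    ext i
    fin_cases i <;> simp [wt, h1, h2, h3]

abbrev TK (k : ℕ) := {t : MTree // t.il ≤ k}

noncomputable def wk (k : ℕ) (t : TK k) : Fin 3 →₀ ℕ := wt t.1

theorem fib_equiv (k : ℕ) (m : Fin 3 →₀ ℕ) : Nonempty ({t : TK k // wk k t = m} ≃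
    {π : Equiv.Perm (Fin (m 2)) // IsMotzkinPerm π ∧ ¬ HasIncr (k + 1) π ∧
      lds π = m 0 ∧ rises π = m 1}) := by
  obtain ⟨e⟩ := tree_equiv (m 2) k (m 0) (m 1)
  refine ⟨Equiv.trans ?_ e⟩
  refine (Equiv.subtypeSubtypeEquivSubtypeInter (fun t : MTree => t.il ≤ k)
    (fun t => wt t = m)).trans (Equiv.subtypeEquivRight ?_)
  intro t
  rw [wt_eq_iff]

theorem FinFib_wk (k : ℕ) : FinFib (wk k) := by
  intro m
  obtain ⟨e⟩ := fib_equiv k m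
  exact Finite.of_equiv _ e.symm

theorem B_eq (k : ℕ) : B k = GF (wk k) := by
  ext m
  obtain ⟨e⟩ := fib_equiv k m
  rw [coeff_GF, Nat.card_congr e]
  rfl

noncomputable def c1 : Fin 3 →₀ ℕ := Finsupp.single 0 1 + Finsupp.single 2 1
noncomputable def c2 : Fin 3 →₀ ℕ := Finsupp.single 0 1 + Finsupp.single 1 1 + Finsupp.single 2 2

theorem mono1 : (MvPowerSeries.monomial c1 1 : MvPowerSeries (Fin 3) ℚ) =
    MvPowerSeries.X 0 * MvPowerSeries.X 2 := by
  rw [MvPowerSeries.X_def, MvPowerSeries.X_def, MvPowerSeries.monomial_mul_monomial, c1, one_mul]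

theorem mono2 : (MvPowerSeries.monomial c2 1 : MvPowerSeries (Fin 3) ℚ) =
    MvPowerSeries.X 0 * MvPowerSeries.X 1 * MvPowerSeries.X 2 ^ 2 := by
  rw [MvPowerSeries.X_pow_eq, MvPowerSeries.X_def, MvPowerSeries.X_def,
    MvPowerSeries.monomial_mul_monomial, MvPowerSeries.monomial_mul_monomial, c2, one_mul, one_mul]

theorem wt_e : wt .e = 0 := by simp [wt, MTree.dl, MTree.rs, MTree.sz]

theorem wt_u (t : MTree) : wt (.u t) = c1 + wt t := by
  ext i
  fin_cases i <;> simp [wt, c1, MTree.dl, MTree.rs, MTree.sz] <;> omega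

theorem wt_b (s t : MTree) : wt (.b s t) = c2 + (wt s + wt t) := by
  ext i
  fin_cases i <;> simp [wt, c2, MTree.dl, MTree.rs, MTree.sz] <;> omega

def eq1 : (Unit ⊕ TK 1) ≃ TK 1 where
  toFun x := match x with
    | .inl _ => ⟨.e, by simp [MTree.il]⟩
    | .inr t => ⟨.u t.1, by have := t.2; simp [MTree.il]; omega⟩
  invFun x := match x with
    | ⟨.e, _⟩ => .inl ()
    | ⟨.u t, h⟩ => .inr ⟨t, by simp [MTree.il] at h; omega⟩
    | ⟨.b s t, h⟩ => absurd h (by simp [MTree.il])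
  left_inv x := by rcases x with _ | t <;> rfl
  right_inv x := by
    rcases x with ⟨_ | t | ⟨s, t⟩, h⟩
    · rfl
    · rfl
    · exact absurd h (by simp [MTree.il])

def eqk (k : ℕ) : (Unit ⊕ (TK (k + 2) ⊕ (TK (k + 1) × TK (k + 2)))) ≃ TK (k + 2) where
  toFun x := match x with
    | .inl _ => ⟨.e, by simp [MTree.il]⟩
    | .inr (.inl t) => ⟨.u t.1, by have := t.2; simp [MTree.il]; omega⟩
    | .inr (.inr (s, t)) => ⟨.b s.1 t.1, by have := t.2; have := s.2; simp [MTree.il]; omega⟩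
  invFun x := match x with
    | ⟨.e, _⟩ => .inl ()
    | ⟨.u t, h⟩ => .inr (.inl ⟨t, by simp [MTree.il] at h; omega⟩)
    | ⟨.b s t, h⟩ => .inr (.inr (⟨s, by simp [MTree.il] at h; omega⟩,
        ⟨t, by simp [MTree.il] at h; omega⟩))
  left_inv x := by rcases x with _ | t | ⟨s, t⟩ <;> rfl
  right_inv x := by rcases x with ⟨_ | t | ⟨s, t⟩, h⟩ <;> rfl

theorem rec1 : B 1 = 1 + MvPowerSeries.X 0 * MvPowerSeries.X 2 * B 1 := by
  rw [← mono1, B_eq, ← GF_shift, ← GF_unit, ← GF_sum _ _ FinFib_unit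
    (FinFib_shift _ _ (FinFib_wk 1))]
  symm
  apply GF_equiv _ _ eq1
  rintro (_ | t)
  · exact wt_e.symm
  · exact (wt_u t.1).symm

theorem reck (k : ℕ) : B (k + 2) = 1 + (MvPowerSeries.X 0 * MvPowerSeries.X 2 * B (k + 2) +
    MvPowerSeries.X 0 * MvPowerSeries.X 1 * MvPowerSeries.X 2 ^ 2 * (B (k + 1) * B (k + 2))) := by
  have f1 := FinFib_wk (k + 1)
  have f2 := FinFib_wk (k + 2)
  rw [← mono1, ← mono2, B_eq, B_eq, ← GF_prod _ _ f1 f2, ← GF_shift, ← GF_shift, ← GF_unit,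
    ← GF_sum _ _ (FinFib_shift _ _ f2) (FinFib_shift _ _ (FinFib_prod _ _ f1 f2)),
    ← GF_sum _ _ FinFib_unit
    (FinFib_sum _ _ (FinFib_shift _ _ f2) (FinFib_shift _ _ (FinFib_prod _ _ f1 f2)))]
  symm
  apply GF_equiv _ _ (eqk k)
  rintro (_ | t | ⟨s, t⟩)
  · exact wt_e.symm
  · exact (wt_u t.1).symm
  · exact (wt_b s.1 t.1).symm

open MvPowerSeries in
/-- `(1 - vx) B₁ = 1` and `(1 - vx - vyx² B_{k-1}) B_k = 1` for `k ≥ 2`. -/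
theorem B_recurrence :
    (1 - (X 0 : MvPowerSeries (Fin 3) ℚ) * X 2) * B 1 = 1 ∧
    ∀ k : ℕ, 2 ≤ k →
      (1 - (X 0 : MvPowerSeries (Fin 3) ℚ) * X 2
          - X 0 * X 1 * (X 2) ^ 2 * B (k - 1)) * B k = 1 := by
  refine ⟨?_, ?_⟩
  · have := rec1
    linear_combination this
  · intro k hk
    obtain ⟨k, rfl⟩ : ∃ j, k = j + 2 := ⟨k - 2, by omega⟩
    have := reck k
    have e : k + 2 - 1 = k + 1 := by omega
    rw [e]
    linear_combination this
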